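/- First Stokeslet difference term at the fiber surface: there exist constants C > 0 and ε₀ > 0, depending only on c_Γ and κ_max, such that for all 0 < ε < ε₀, 0 < δ < ε₀, every f ∈ C¹(ℝ/ℤ; ℝ³), every s ∈ ℝ/ℤ and θ ∈ [0,2π), the quantity S₁ = ∫_{−1/2}^{1/2} ( 1/(|R(s,s̄,θ)|² + δ²)^{1/2} − 1/|R(s,s̄,θ)| ) f(s − s̄) ds̄ satisfies |S₁ + log(1 + δ²/ε²) f(s)| ≤ C ‖f‖_{C¹} (ε² + δ²)^{1/2} |log(ε² + δ²)|. -/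

import Mathlib

open MeasureTheory

noncomputable section

local notation "⟪" x ", " y "⟫" => @inner ℝ _ _ x y

abbrev V3 : Type := EuclideanSpace ℝ (Fin 3)

/-- The `C⁰` (sup) norm of a function `ℝ/ℤ → ℝ³`. -/
def C0norm (f : ℝ → V3) : ℝ := ⨆ s : ℝ, ‖f s‖

/-- The `C¹` norm of a function `ℝ/ℤ → ℝ³`. -/
def C1norm (f : ℝ → V3) : ℝ := C0norm f + C0norm (deriv f)

/-- The radial unit vector `e_ρ(s,θ) = cos θ e_{n1}(s) + sin θ e_{n2}(s)`. -/
def ePerp (en1 en2 : ℝ → V3) (s θ : ℝ) : V3 :=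
  Real.cos θ • en1 s + Real.sin θ • en2 s

/-- `R(s, s̄, θ) = X(s) + ε e_ρ(s,θ) − X(s − s̄)`. -/
def Rvec (X en1 en2 : ℝ → V3) (ε s sb θ : ℝ) : V3 :=
  X s + ε • ePerp en1 en2 s θ - X (s - sb)

/-- The slender-body geometry hypotheses: `X : ℝ/ℤ → ℝ³` is a `C²` closed curve
parameterized by arclength, non-self-intersecting with constant `cΓ`, with curvature
bounded by `κmax`, together with a `C¹` orthonormal frame `(X', en1, en2)`. -/
structure SlenderGeom (cΓ κmax : ℝ) (X en1 en2 : ℝ → V3) : Prop where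
  smooth : ContDiff ℝ 2 X
  periodicX : ∀ s, X (s + 1) = X s
  arclength : ∀ s, ‖deriv X s‖ = 1
  no_self_intersect : ∀ s t : ℝ, |s - t| ≤ 1 / 2 → cΓ * |s - t| ≤ ‖X s - X t‖
  curvature_max : ∀ s, ‖deriv (deriv X) s‖ ≤ κmax
  en1_smooth : ContDiff ℝ 1 en1
  en2_smooth : ContDiff ℝ 1 en2
  en1_periodic : ∀ s, en1 (s + 1) = en1 s
  en2_periodic : ∀ s, en2 (s + 1) = en2 s
  en1_unit : ∀ s, ‖en1 s‖ = 1
  en2_unit : ∀ s, ‖en2 s‖ = 1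
  es_en1 : ∀ s, ⟪deriv X s, en1 s⟫ = 0
  es_en2 : ∀ s, ⟪deriv X s, en2 s⟫ = 0
  en1_en2 : ∀ s, ⟪en1 s, en2 s⟫ = 0

/-- The singular Stokeslet `S(y) v = v/|y| + (y·v) y/|y|³`. -/
def stokeslet (y v : V3) : V3 := ‖y‖⁻¹ • v + (‖y‖ ^ 3)⁻¹ • ⟪y, v⟫ • y

/-- The singular doublet `D(y) v = v/|y|³ − 3 (y·v) y/|y|⁵`. -/
def doubletK (y v : V3) : V3 := (‖y‖ ^ 3)⁻¹ • v - (3 * (‖y‖ ^ 5)⁻¹) • ⟪y, v⟫ • y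

/-- The regularized Stokeslet `S_δ(y) v`. -/
def stokesletReg (δ : ℝ) (y v : V3) : V3 :=
  ((‖y‖ ^ 2 + δ ^ 2) ^ ((1 : ℝ) / 2))⁻¹ • v
    + ((‖y‖ ^ 2 + δ ^ 2) ^ ((3 : ℝ) / 2))⁻¹ • (⟪y, v⟫ • y + δ ^ 2 • v)

/-- The regularized doublet `D_δ(y) v`. -/
def doubletReg (δ : ℝ) (y v : V3) : V3 :=
  ((‖y‖ ^ 2 + δ ^ 2) ^ ((3 : ℝ) / 2))⁻¹ • v
    - (3 * ((‖y‖ ^ 2 + δ ^ 2) ^ ((5 : ℝ) / 2))⁻¹) • (⟪y, v⟫ • y + δ ^ 2 • v)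

/-- The classical slender-body velocity `u^SB(x)` with doublet coefficient `ε²/2`. -/
def uSB (X f : ℝ → V3) (ε : ℝ) (x : V3) : V3 :=
  (8 * Real.pi)⁻¹ • ∫ t in (0:ℝ)..1,
    (stokeslet (x - X t) (f t) + (ε ^ 2 / 2) • doubletK (x - X t) (f t))

/-- The regularized slender-body velocity with doublet coefficient `β`. -/
def uReg (X f : ℝ → V3) (β δ : ℝ) (x : V3) : V3 :=
  (8 * Real.pi)⁻¹ • ∫ t in (0:ℝ)..1,
    (stokesletReg δ (x - X t) (f t) + β • doubletReg δ (x - X t) (f t))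

/-- The Keller–Rubinow classical centerline velocity `u^SB_C(X(s))`. -/
def uSBC (X f : ℝ → V3) (ε s : ℝ) : V3 :=
  (8 * Real.pi)⁻¹ •
    ((f s - (3 : ℝ) • ⟪deriv X s, f s⟫ • deriv X s
        - (2 * Real.log (Real.pi * ε / 4)) • (f s + ⟪deriv X s, f s⟫ • deriv X s))
      + ∫ t in (0:ℝ)..1,
          ((‖X s - X t‖⁻¹ • f t
              + (‖X s - X t‖ ^ 3)⁻¹ • ⟪X s - X t, f t⟫ • (X s - X t))
            - |Real.sin (Real.pi * (s - t)) / Real.pi|⁻¹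
                • (f s + ⟪deriv X s, f s⟫ • deriv X s)))

/-- The regularized pressure `p^δ(x)`. -/
def pReg (X f : ℝ → V3) (δ : ℝ) (x : V3) : ℝ :=
  (4 * Real.pi)⁻¹ * ∫ t in (0:ℝ)..1,
    (⟪x - X t, f t⟫ * ((‖x - X t‖ ^ 2 + δ ^ 2) ^ ((3 : ℝ) / 2))⁻¹
      + 3 * δ ^ 2 * ⟪x - X t, f t⟫ * (2 * (‖x - X t‖ ^ 2 + δ ^ 2) ^ ((5 : ℝ) / 2))⁻¹)

/-- The symmetric strain tensor `E(u) = (∇u + (∇u)ᵀ)/2` applied to the vector `n`. -/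
def strainApply (u : V3 → V3) (x n : V3) : V3 :=
  (2 : ℝ)⁻¹ • (fderiv ℝ u x n + gradient (fun y => ⟪u y, n⟫) x)

/-- The surface Jacobian `J_ε(s,θ) = ε(1 − ε(κ₁ cos θ + κ₂ sin θ))`. -/
def Jfac (X en1 en2 : ℝ → V3) (ε s θ : ℝ) : ℝ :=
  ε * (1 - ε * (⟪deriv (deriv X) s, en1 s⟫ * Real.cos θ
      + ⟪deriv (deriv X) s, en2 s⟫ * Real.sin θ))

/-- The regularized surface force density
`f^δ(s) = ∫_0^{2π} (2 E(u^δ) n − p^δ n) J_ε dθ`, with `n = −e_ρ`. -/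
def fReg (X en1 en2 f : ℝ → V3) (ε δ s : ℝ) : V3 :=
  ∫ θ in (0:ℝ)..(2 * Real.pi),
    Jfac X en1 en2 ε s θ •
      ((2 : ℝ) • strainApply (uReg X f ((ε ^ 2 + δ ^ 2) / 2) δ)
          (X s + ε • ePerp en1 en2 s θ) (-ePerp en1 en2 s θ)
        - pReg X f δ (X s + ε • ePerp en1 en2 s θ) • (-ePerp en1 en2 s θ))

/-- The vector field `d_n^δ[f](x)`. -/
def dReg (X f : ℝ → V3) (δ : ℝ) (n : ℕ) (x : V3) : V3 :=
  (8 * Real.pi)⁻¹ • ∫ t in (0:ℝ)..1,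
    (δ ^ 2 * ((‖x - X t‖ ^ 2 + δ ^ 2) ^ ((n : ℝ) / 2))⁻¹) • f t

/-- The scalar field `d_5^δ[f·R](x)`. -/
def dRegP (X f : ℝ → V3) (δ : ℝ) (x : V3) : ℝ :=
  (8 * Real.pi)⁻¹ * ∫ t in (0:ℝ)..1,
    δ ^ 2 * ⟪x - X t, f t⟫ * ((‖x - X t‖ ^ 2 + δ ^ 2) ^ ((5 : ℝ) / 2))⁻¹

/-- The extra force contribution
`F^δ(s) = ∫_0^{2π} (2E(d₃^δ[f])n − 3(ε²+δ²)E(d₅^δ[f])n − 3 d₅^δ[f·R] n) J_ε dθ`. -/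
def Fextra (X en1 en2 f : ℝ → V3) (ε δ s : ℝ) : V3 :=
  ∫ θ in (0:ℝ)..(2 * Real.pi),
    Jfac X en1 en2 ε s θ •
      ((2 : ℝ) • strainApply (dReg X f δ 3) (X s + ε • ePerp en1 en2 s θ)
          (-ePerp en1 en2 s θ)
        - (3 * (ε ^ 2 + δ ^ 2)) • strainApply (dReg X f δ 5)
            (X s + ε • ePerp en1 en2 s θ) (-ePerp en1 en2 s θ)
        - (3 * dRegP X f δ (X s + ε • ePerp en1 en2 s θ)) • (-ePerp en1 en2 s θ))

open Real Set intervalIntegral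

/-- The difference between the regularized and the singular radial kernel. -/
def kernelDiff (δ y : ℝ) : ℝ := (√(y ^ 2 + δ ^ 2))⁻¹ - y⁻¹

lemma sqrt_sq_add_sq_pos {δ : ℝ} (hδ : 0 < δ) (y : ℝ) : 0 < √(y ^ 2 + δ ^ 2) :=
  sqrt_pos.mpr (by positivity)

lemma le_sqrt_sq_add_sq (δ y : ℝ) : y ≤ √(y ^ 2 + δ ^ 2) :=
  le_sqrt_of_sq_le (by nlinarith [sq_nonneg δ])

lemma abs_kernelDiff_le {δ y : ℝ} (hδ : 0 < δ) (hy : 0 < y) :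
    |kernelDiff δ y| ≤ δ ^ 2 / (y * (y ^ 2 + δ ^ 2)) := by
  have hA := sqrt_sq_add_sq_pos hδ y
  have hAy := le_sqrt_sq_add_sq δ y
  have hsq : √(y ^ 2 + δ ^ 2) ^ 2 = y ^ 2 + δ ^ 2 := sq_sqrt (by positivity)
  unfold kernelDiff
  set A := √(y ^ 2 + δ ^ 2)
  rw [← hsq]
  have hd : δ ^ 2 = (A - y) * (A + y) := by linarith
  have h1 : A⁻¹ ≤ y⁻¹ := inv_anti₀ hy hAy
  rw [abs_of_nonpos (by linarith), hd]
  have : -(A⁻¹ - y⁻¹) = (A - y) * A / (y * A ^ 2) := by field_simp; ring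
  rw [this]
  gcongr
  linarith

lemma hasDerivAt_kernelDiff {δ y : ℝ} (hδ : 0 < δ) (hy : 0 < y) :
    HasDerivAt (kernelDiff δ)
      ((y ^ 2)⁻¹ - y / √(y ^ 2 + δ ^ 2) ^ 3) y := by
  have hA := sqrt_sq_add_sq_pos hδ y
  have h1 : HasDerivAt (fun y : ℝ => y ^ 2 + δ ^ 2) (2 * y) y := by
    simpa using (hasDerivAt_pow 2 y).add_const (δ ^ 2)
  have h2 := ((h1.sqrt (by positivity)).inv hA.ne').sub (hasDerivAt_inv hy.ne')
  refine h2.congr_deriv ?_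
  field_simp
  ring

lemma abs_deriv_kernelDiff_le {δ m y : ℝ} (hδ : 0 < δ) (hm : 0 < m) (hmy : m ≤ y) :
    ‖(y ^ 2)⁻¹ - y / √(y ^ 2 + δ ^ 2) ^ 3‖ ≤ 3 * δ ^ 2 / (m ^ 2 * (m ^ 2 + δ ^ 2)) := by
  have hy : 0 < y := hm.trans_le hmy
  have hA := sqrt_sq_add_sq_pos hδ y
  have hAy := le_sqrt_sq_add_sq δ y
  have hsq : √(y ^ 2 + δ ^ 2) ^ 2 = y ^ 2 + δ ^ 2 := sq_sqrt (by positivity)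
  have key : 3 * δ ^ 2 / (y ^ 2 * (y ^ 2 + δ ^ 2)) ≤ 3 * δ ^ 2 / (m ^ 2 * (m ^ 2 + δ ^ 2)) := by
    gcongr
  refine le_trans ?_ key
  set A := √(y ^ 2 + δ ^ 2)
  rw [← hsq]
  have hd : δ ^ 2 = (A - y) * (A + y) := by linarith
  have h0 : 0 ≤ A - y := by linarith
  have e : (y ^ 2)⁻¹ - y / A ^ 3 = (A - y) * (A ^ 2 + A * y + y ^ 2) / (y ^ 2 * A ^ 3) := by
    field_simp
    ring
  rw [e, Real.norm_of_nonneg (by positivity), hd]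
  rw [div_le_div_iff₀ (by positivity) (by positivity)]
  have h3 : A ^ 2 + A * y + y ^ 2 ≤ 3 * (A + y) * A := by nlinarith
  have h4 : 0 ≤ (A - y) * (y ^ 2 * A ^ 2) := by positivity
  nlinarith [mul_le_mul_of_nonneg_left h3 h4]

lemma abs_kernelDiff_sub_le {δ m x y : ℝ} (hδ : 0 < δ) (hm : 0 < m) (hx : m ≤ x) (hy : m ≤ y) :
    |kernelDiff δ y - kernelDiff δ x| ≤ 3 * δ ^ 2 / (m ^ 2 * (m ^ 2 + δ ^ 2)) * |y - x| :=
  (convex_Ici m).norm_image_sub_le_of_norm_hasDerivWithin_le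
    (fun _ hz => (hasDerivAt_kernelDiff hδ (hm.trans_le hz)).hasDerivWithinAt)
    (fun _ hz => abs_deriv_kernelDiff_le hδ hm hz) hx hy

lemma hasDerivAt_arsinh_div {a : ℝ} (ha : 0 < a) (t : ℝ) :
    HasDerivAt (fun t => arsinh (t / a)) (√(t ^ 2 + a ^ 2))⁻¹ t := by
  have h := ((hasDerivAt_id t).div_const a).arsinh
  refine h.congr_deriv ?_
  have : √(t ^ 2 + a ^ 2) = a * √(1 + (t / a) ^ 2) := by
    rw [← sqrt_sq ha.le, ← sqrt_mul (by positivity), sqrt_sq ha.le]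
    congr 1
    field_simp
    ring
  simp only [id]
  rw [this]
  have : 0 < √(1 + (t / a) ^ 2) := sqrt_pos.mpr (by positivity)
  simp only [smul_eq_mul]
  field_simp

lemma continuous_inv_sqrt_sq_add_sq {a : ℝ} (ha : 0 < a) :
    Continuous fun t : ℝ => (√(t ^ 2 + a ^ 2))⁻¹ :=
  (by fun_prop : Continuous fun t : ℝ => √(t ^ 2 + a ^ 2)).inv₀
    fun t => (sqrt_sq_add_sq_pos ha t).ne'

lemma integral_inv_sqrt_sq_add_sq {a : ℝ} (ha : 0 < a) :
    ∫ t in (-(1:ℝ)/2)..(1/2), (√(t ^ 2 + a ^ 2))⁻¹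
      = 2 * (log (1 / 2 + √(1 / 4 + a ^ 2)) - log a) := by
  rw [integral_eq_sub_of_hasDerivAt (fun t _ => hasDerivAt_arsinh_div ha t)
    ((continuous_inv_sqrt_sq_add_sq ha).intervalIntegrable _ _)]
  have e : -(1:ℝ) / 2 / a = -(1 / 2 / a) := by ring
  rw [e, arsinh_neg, arsinh, ← log_div (by positivity) ha.ne']
  have : √(1 / 4 + a ^ 2) = a * √(1 + (1 / 2 / a) ^ 2) := by
    rw [← sqrt_sq ha.le, ← sqrt_mul (by positivity), sqrt_sq ha.le]
    congr 1
    field_simp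
    ring
  rw [this]
  have : (1 / 2 + a * √(1 + (1 / 2 / a) ^ 2)) / a = 1 / 2 / a + √(1 + (1 / 2 / a) ^ 2) := by
    field_simp
  rw [this]
  ring

lemma kernelDiff_sqrt {ε : ℝ} (δ t : ℝ) :
    kernelDiff δ (√(t ^ 2 + ε ^ 2))
      = (√(t ^ 2 + √(ε ^ 2 + δ ^ 2) ^ 2))⁻¹ - (√(t ^ 2 + ε ^ 2))⁻¹ := by
  rw [kernelDiff, sq_sqrt (by positivity), sq_sqrt (by positivity), add_assoc]

lemma continuous_kernelDiff_sqrt {ε δ : ℝ} (hε : 0 < ε) :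
    Continuous fun t => kernelDiff δ (√(t ^ 2 + ε ^ 2)) := by
  have ha : 0 < √(ε ^ 2 + δ ^ 2) := sqrt_pos.mpr (by positivity)
  simp only [kernelDiff_sqrt]
  exact (continuous_inv_sqrt_sq_add_sq ha).sub (continuous_inv_sqrt_sq_add_sq hε)

/-- The integral over a straight segment equals the logarithm up to a quadratic error. -/
lemma abs_integral_kernelDiff_add_log_le {ε δ : ℝ} (hε : 0 < ε) :
    |(∫ t in (-(1:ℝ)/2)..(1/2), kernelDiff δ (√(t ^ 2 + ε ^ 2))) + log (1 + δ ^ 2 / ε ^ 2)|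
      ≤ 2 * (ε ^ 2 + δ ^ 2) := by
  have ha : 0 < √(ε ^ 2 + δ ^ 2) := sqrt_pos.mpr (by positivity)
  simp only [kernelDiff_sqrt]
  rw [integral_sub ((continuous_inv_sqrt_sq_add_sq ha).intervalIntegrable _ _)
    ((continuous_inv_sqrt_sq_add_sq hε).intervalIntegrable _ _),
    integral_inv_sqrt_sq_add_sq ha, integral_inv_sqrt_sq_add_sq hε]
  have hl : log (1 + δ ^ 2 / ε ^ 2) = 2 * (log √(ε ^ 2 + δ ^ 2) - log ε) := by
    have : 1 + δ ^ 2 / ε ^ 2 = (√(ε ^ 2 + δ ^ 2) / ε) ^ 2 := by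
      rw [div_pow, sq_sqrt (by positivity)]
      field_simp
    rw [this, log_pow, log_div ha.ne' hε.ne']
    norm_num
  rw [hl, sq_sqrt (by positivity)]
  set p := √(1 / 4 + (ε ^ 2 + δ ^ 2)) with hp
  set q := √(1 / 4 + ε ^ 2) with hq
  have hqp : q ≤ p := sqrt_le_sqrt (by nlinarith [sq_nonneg δ])
  have hq1 : 1 / 2 ≤ q := le_sqrt_of_sq_le (by nlinarith [sq_nonneg ε])
  have hp1 : p ≤ 1 / 2 + (ε ^ 2 + δ ^ 2) := by
    rw [hp, sqrt_le_left (by positivity)]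
    nlinarith [sq_nonneg (ε ^ 2 + δ ^ 2)]
  have h1 : log (1 / 2 + q) ≤ log (1 / 2 + p) := log_le_log (by linarith) (by linarith)
  have h2 : log (1 / 2 + p) - log (1 / 2 + q) ≤ ε ^ 2 + δ ^ 2 := by
    rw [← log_div (by linarith) (by linarith)]
    refine (log_le_sub_one_of_pos (div_pos (by linarith) (by linarith))).trans ?_
    rw [sub_le_iff_le_add, div_le_iff₀ (by linarith)]
    nlinarith [sq_nonneg ε, sq_nonneg δ]
  rw [abs_le]
  constructor <;> nlinarith [sq_nonneg ε, sq_nonneg δ]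

lemma continuous_sq_div_sq_add_sq {δ : ℝ} (hδ : 0 < δ) :
    Continuous fun t : ℝ => δ ^ 2 / (t ^ 2 + δ ^ 2) :=
  continuous_const.div (by fun_prop) fun t => by positivity

lemma integral_sq_div_sq_add_sq_le {δ : ℝ} (hδ : 0 < δ) (a b : ℝ) :
    ∫ t in a..b, δ ^ 2 / (t ^ 2 + δ ^ 2) ≤ π * δ := by
  have hd : ∀ t ∈ uIcc a b,
      HasDerivAt (fun t => δ * arctan (t / δ)) (δ ^ 2 / (t ^ 2 + δ ^ 2)) t := by
    intro t _
    refine ((((hasDerivAt_id t).div_const δ).arctan).const_mul δ).congr_deriv ?_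
    simp only [id]
    field_simp
    ring
  rw [integral_eq_sub_of_hasDerivAt hd
    ((continuous_sq_div_sq_add_sq hδ).intervalIntegrable _ _)]
  nlinarith [arctan_lt_pi_div_two (b / δ), neg_pi_div_two_lt_arctan (a / δ)]

lemma norm_le_C0norm {f : ℝ → V3} (hf : Continuous f) (hp : ∀ s, f (s + 1) = f s) (s : ℝ) :
    ‖f s‖ ≤ C0norm f := by
  have hp' : Function.Periodic f 1 := hp
  have hb := hp'.isBounded_of_continuous one_ne_zero hf
  obtain ⟨B, hB⟩ := hb.exists_norm_le
  exact le_ciSup (f := fun s => ‖f s‖) ⟨B, by rintro _ ⟨t, rfl⟩; exact hB _ ⟨t, rfl⟩⟩ s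

lemma norm_sub_le_C0norm_deriv {f : ℝ → V3} (hf : ContDiff ℝ 1 f) (hp : ∀ s, f (s + 1) = f s)
    (s t : ℝ) : ‖f (s - t) - f s‖ ≤ C0norm (deriv f) * |t| := by
  have hp' : ∀ s, deriv f (s + 1) = deriv f s := fun s => by
    rw [← deriv_comp_add_const]
    simp only [hp]
  have h := convex_univ.norm_image_sub_le_of_norm_deriv_le (f := f) (𝕜 := ℝ)
    (fun x _ => (hf.differentiable one_ne_zero) x)
    (fun x _ => norm_le_C0norm (hf.continuous_deriv le_rfl) hp' x) (mem_univ s) (mem_univ (s - t))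
  simpa using h

namespace SlenderGeom

variable {cΓ κmax : ℝ} {X en1 en2 : ℝ → V3}

lemma norm_taylor_le (h : SlenderGeom cΓ κmax X en1 en2) (s t : ℝ) :
    ‖X s - X (s - t) - t • deriv X s‖ ≤ κmax * t ^ 2 := by
  have hX' : ContDiff ℝ 1 (deriv X) := (contDiff_succ_iff_deriv.mp h.smooth).2.2
  have hκ : 0 ≤ κmax := (norm_nonneg _).trans (h.curvature_max 0)
  have hlip : ∀ x, ‖deriv X x - deriv X s‖ ≤ κmax * ‖x - s‖ := fun x =>
    convex_univ.norm_image_sub_le_of_norm_deriv_le (f := deriv X) (𝕜 := ℝ)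
      (fun x _ => (hX'.differentiable one_ne_zero) x)
      (fun x _ => h.curvature_max x) (mem_univ s) (mem_univ x)
  have hd : ∀ x ∈ uIcc s (s - t), HasDerivWithinAt (fun x => X x - x • deriv X s)
      (deriv X x - deriv X s) (uIcc s (s - t)) x := fun x _ => by
    have h1 := ((h.smooth.differentiable two_ne_zero) x).hasDerivAt
    have h2 := (hasDerivAt_id x).smul_const (deriv X s)
    rw [one_smul] at h2
    exact (h1.sub h2).hasDerivWithinAt
  have hb : ∀ x ∈ uIcc s (s - t), ‖deriv X x - deriv X s‖ ≤ κmax * |t| := fun x hx => by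
    refine (hlip x).trans (mul_le_mul_of_nonneg_left ?_ hκ)
    have := abs_sub_left_of_mem_uIcc hx
    simpa using this
  have := (convex_uIcc s (s - t)).norm_image_sub_le_of_norm_hasDerivWithin_le hd hb
    right_mem_uIcc left_mem_uIcc
  have e : X s - s • deriv X s - (X (s - t) - (s - t) • deriv X s)
      = X s - X (s - t) - t • deriv X s := by
    module
  rw [e] at this
  refine this.trans (le_of_eq ?_)
  rw [sub_sub_cancel, norm_eq_abs, mul_assoc, ← abs_mul, abs_mul_self]
  ring

lemma norm_smul_add_smul_ePerp (h : SlenderGeom cΓ κmax X en1 en2) (ε s t θ : ℝ) :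
    ‖t • deriv X s + ε • ePerp en1 en2 s θ‖ = √(t ^ 2 + ε ^ 2) := by
  rw [eq_comm, sqrt_eq_iff_mul_self_eq (by positivity) (norm_nonneg _),
    ← real_inner_self_eq_norm_mul_norm]
  have h1 : ⟪deriv X s, deriv X s⟫ = 1 := by
    rw [real_inner_self_eq_norm_sq, h.arclength]; norm_num
  have h2 : ⟪en1 s, en1 s⟫ = 1 := by
    rw [real_inner_self_eq_norm_sq, h.en1_unit]; norm_num
  have h3 : ⟪en2 s, en2 s⟫ = 1 := by
    rw [real_inner_self_eq_norm_sq, h.en2_unit]; norm_num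
  have h4 : ⟪en1 s, deriv X s⟫ = 0 := by rw [real_inner_comm, h.es_en1]
  have h5 : ⟪en2 s, deriv X s⟫ = 0 := by rw [real_inner_comm, h.es_en2]
  have h6 : ⟪en2 s, en1 s⟫ = 0 := by rw [real_inner_comm, h.en1_en2]
  simp only [ePerp, inner_add_left, inner_add_right, real_inner_smul_left, real_inner_smul_right,
    h1, h2, h3, h4, h5, h6, h.es_en1, h.es_en2, h.en1_en2]
  nlinarith [sin_sq_add_cos_sq θ]

lemma norm_ePerp (h : SlenderGeom cΓ κmax X en1 en2) (s θ : ℝ) : ‖ePerp en1 en2 s θ‖ = 1 := by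
  simpa using h.norm_smul_add_smul_ePerp 1 s 0 θ

lemma abs_norm_Rvec_sub_le (h : SlenderGeom cΓ κmax X en1 en2) (ε s t θ : ℝ) :
    |‖Rvec X en1 en2 ε s t θ‖ - √(t ^ 2 + ε ^ 2)| ≤ κmax * t ^ 2 := by
  rw [← h.norm_smul_add_smul_ePerp ε s t θ]
  refine (abs_norm_sub_norm_le _ _).trans ?_
  refine le_trans (le_of_eq ?_) (h.norm_taylor_le s t)
  congr 1
  rw [Rvec]
  module

/-- The distance to the curve is comparable to that of the straight configuration. -/
lemma mul_sqrt_le_norm_Rvec (h : SlenderGeom cΓ κmax X en1 en2) (hc : 0 < cΓ) {ε : ℝ}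
    (hε : 0 < ε) (hε' : ε * (4 * (|κmax| + 1)) ≤ cΓ) (s θ : ℝ) {t : ℝ} (ht : |t| ≤ 1 / 2) :
    min (1 / 2) (cΓ / (2 + cΓ)) * √(t ^ 2 + ε ^ 2) ≤ ‖Rvec X en1 en2 ε s t θ‖ := by
  set r := √(t ^ 2 + ε ^ 2) with hr
  have hr0 : 0 ≤ r := sqrt_nonneg _
  have htr : |t| ≤ r := by
    rw [← sqrt_sq_eq_abs]
    exact sqrt_le_sqrt (by nlinarith [sq_nonneg ε])
  have hrt : r ≤ |t| + ε := by
    rw [hr, sqrt_le_left (by positivity)]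
    nlinarith [sq_abs t, mul_nonneg (abs_nonneg t) hε.le]
  have hK : κmax ≤ |κmax| + 1 := (le_abs_self _).trans (by linarith)
  have hK1 : 0 < |κmax| + 1 := by positivity
  set K := |κmax| + 1
  rcases le_total (2 * K * |t|) 1 with hsmall | hlarge
  · have h1 := (abs_le.mp (h.abs_norm_Rvec_sub_le ε s t θ)).1
    have h2 : κmax * t ^ 2 ≤ r / 2 := by
      rw [← sq_abs]
      have : κmax * |t| ^ 2 ≤ K * |t| ^ 2 := by gcongr
      nlinarith [abs_nonneg t, mul_nonneg hK1.le (abs_nonneg t)]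
    have h3 : min (1 / 2) (cΓ / (2 + cΓ)) * r ≤ 1 / 2 * r :=
      mul_le_mul_of_nonneg_right (min_le_left _ _) hr0
    linarith
  · have h1 : cΓ * |t| ≤ ‖X s - X (s - t)‖ := by
      simpa using h.no_self_intersect s (s - t) (by simpa using ht)
    have h2 : ‖X s - X (s - t)‖ ≤ ‖Rvec X en1 en2 ε s t θ‖ + ε := by
      have e : X s - X (s - t) = Rvec X en1 en2 ε s t θ - ε • ePerp en1 en2 s θ := by
        rw [Rvec]; module
      rw [e]
      refine (norm_sub_le _ _).trans ?_
      rw [norm_smul, h.norm_ePerp, mul_one, norm_of_nonneg hε.le]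
    have h3 : ε ≤ cΓ * |t| / 2 := by
      have : ε * (4 * K) ≤ cΓ * |t| / 2 * (4 * K) := by nlinarith
      exact le_of_mul_le_mul_right this (by positivity)
    have h4 : min (1 / 2) (cΓ / (2 + cΓ)) * r ≤ cΓ / (2 + cΓ) * (|t| + cΓ * |t| / 2) := by
      gcongr
      · exact min_le_right _ _
      · linarith
    have h5 : cΓ / (2 + cΓ) * (|t| + cΓ * |t| / 2) = cΓ * |t| / 2 := by field_simp
    linarith

lemma continuous_norm_Rvec (h : SlenderGeom cΓ κmax X en1 en2) (ε s θ : ℝ) :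
    Continuous fun t => ‖Rvec X en1 en2 ε s t θ‖ := by
  have := h.smooth.continuous
  unfold Rvec
  fun_prop

end SlenderGeom

lemma kernelDiff_error_le {c K δ t r R : ℝ} (hc : 0 < c) (hc1 : c ≤ 1) (hK : 0 ≤ K) (hδ : 0 < δ)
    (hr : 0 < r) (htr : |t| ≤ r) (hR : c * r ≤ R) (hRr : |R - r| ≤ K * t ^ 2) :
    |kernelDiff δ R| * |t| ≤ 1 / c ^ 3 * (δ ^ 2 / (t ^ 2 + δ ^ 2)) ∧
    |kernelDiff δ R - kernelDiff δ r| ≤ 3 * K / c ^ 4 * (δ ^ 2 / (t ^ 2 + δ ^ 2)) := by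
  have hcr : 0 < c * r := by positivity
  have hR0 : 0 < R := hcr.trans_le hR
  have htr2 : t ^ 2 ≤ r ^ 2 := sq_le_sq' (by linarith [(abs_le.mp htr).1]) (abs_le.mp htr).2
  have hc2 : c ^ 2 ≤ 1 := pow_le_one₀ hc.le hc1
  have hden : c ^ 2 * (t ^ 2 + δ ^ 2) ≤ (c * r) ^ 2 + δ ^ 2 := by
    nlinarith [sq_nonneg c, sq_nonneg δ, mul_le_mul_of_nonneg_left htr2 (sq_nonneg c),
      mul_le_mul_of_nonneg_right hc2 (sq_nonneg δ)]
  constructor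
  · calc |kernelDiff δ R| * |t| ≤ δ ^ 2 / (R * (R ^ 2 + δ ^ 2)) * r := by
          exact mul_le_mul (abs_kernelDiff_le hδ hR0) htr (abs_nonneg t)
            ((abs_nonneg _).trans (abs_kernelDiff_le hδ hR0))
      _ ≤ δ ^ 2 / ((c * r) * ((c * r) ^ 2 + δ ^ 2)) * r := by gcongr
      _ ≤ δ ^ 2 / ((c * r) * (c ^ 2 * (t ^ 2 + δ ^ 2))) * r := by gcongr
      _ = 1 / c ^ 3 * (δ ^ 2 / (t ^ 2 + δ ^ 2)) := by field_simp
  · calc |kernelDiff δ R - kernelDiff δ r|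
        ≤ 3 * δ ^ 2 / ((c * r) ^ 2 * ((c * r) ^ 2 + δ ^ 2)) * |R - r| :=
          abs_kernelDiff_sub_le hδ hcr (by nlinarith) hR
      _ ≤ 3 * δ ^ 2 / ((c * r) ^ 2 * (c ^ 2 * (t ^ 2 + δ ^ 2))) * (K * r ^ 2) := by
          gcongr
          exact hRr.trans (by gcongr)
      _ = 3 * K / c ^ 4 * (δ ^ 2 / (t ^ 2 + δ ^ 2)) := by field_simp

lemma one_le_abs_log {x : ℝ} (hx : 0 < x) (hx' : x ≤ 1 / 8) : 1 ≤ |log x| := by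
  have h1 : log x ≤ log (1 / 8) := log_le_log hx hx'
  have h2 : log (1 / 8 : ℝ) = -(3 * log 2) := by
    rw [show (1 / 8 : ℝ) = (2 ^ 3)⁻¹ by norm_num, log_inv, log_pow]
    norm_num
  rw [abs_of_nonpos] <;> linarith [log_two_gt_d9]

/-- First Stokeslet difference term at the fiber surface:
`|S₁ + log(1 + δ²/ε²) f(s)| ≤ C ‖f‖_{C¹} √(ε²+δ²) |log(ε²+δ²)|`. -/
theorem surface_stokeslet_term_S1 (cΓ κmax : ℝ) (hcΓ : 0 < cΓ) :
    ∃ C > 0, ∃ ε₀ > 0,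
      ∀ X en1 en2 : ℝ → V3, SlenderGeom cΓ κmax X en1 en2 →
      ∀ ε δ : ℝ, 0 < ε → ε < ε₀ → 0 < δ → δ < ε₀ →
      ∀ f : ℝ → V3, ContDiff ℝ 1 f → (∀ s, f (s + 1) = f s) →
      ∀ s θ : ℝ,
        ‖(∫ sb in (-(1:ℝ)/2)..(1/2),
              (((‖Rvec X en1 en2 ε s sb θ‖ ^ 2 + δ ^ 2) ^ ((1 : ℝ) / 2))⁻¹
                  - ‖Rvec X en1 en2 ε s sb θ‖⁻¹) • f (s - sb))
            + Real.log (1 + δ ^ 2 / ε ^ 2) • f s‖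
          ≤ C * C1norm f * (ε ^ 2 + δ ^ 2) ^ ((1 : ℝ) / 2)
              * |Real.log (ε ^ 2 + δ ^ 2)| := by
  set c := min (1 / 2) (cΓ / (2 + cΓ)) with hc_def
  have hc : 0 < c := lt_min (by norm_num) (by positivity)
  have hc1 : c ≤ 1 := (min_le_left _ _).trans (by norm_num)
  set M := 1 / c ^ 3 + 3 * |κmax| / c ^ 4 with hM_def
  have hM : 0 < M := by positivity
  refine ⟨M * π + 2, by positivity, min (1 / 4) (cΓ / (4 * (|κmax| + 1))), by positivity, ?_⟩
  intro X en1 en2 hX ε δ hε hε₀ hδ hδ₀ f hf hfp s θ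
  have hε1 : ε < 1 / 4 := hε₀.trans_le (min_le_left _ _)
  have hδ1 : δ < 1 / 4 := hδ₀.trans_le (min_le_left _ _)
  have hε2 : ε * (4 * (|κmax| + 1)) ≤ cΓ := by
    rw [← le_div_iff₀ (by positivity)]
    exact hε₀.le.trans (min_le_right _ _)
  simp only [← sqrt_eq_rpow]
  set R : ℝ → ℝ := fun t => ‖Rvec X en1 en2 ε s t θ‖ with hR_def
  set r : ℝ → ℝ := fun t => √(t ^ 2 + ε ^ 2) with hr_def
  have hr : ∀ t, 0 < r t := sqrt_sq_add_sq_pos hε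
  have hmem : ∀ t ∈ uIcc (-(1:ℝ)/2) (1/2), |t| ≤ 1 / 2 := fun t ht => by
    rw [uIcc_of_le (by norm_num)] at ht
    exact abs_le.mpr ⟨by linarith [ht.1], ht.2⟩
  have hRr : ∀ t ∈ uIcc (-(1:ℝ)/2) (1/2), c * r t ≤ R t := fun t ht =>
    hX.mul_sqrt_le_norm_Rvec hcΓ hε hε2 s θ (hmem t ht)
  have hF0 : ‖f s‖ ≤ C0norm f := norm_le_C0norm hf.continuous hfp s
  have hF1 : 0 ≤ C0norm (deriv f) := by
    simpa using (norm_nonneg _).trans (norm_sub_le_C0norm_deriv hf hfp s 1)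
  have hF00 : 0 ≤ C0norm f := (norm_nonneg _).trans hF0
  have hpt : ∀ t ∈ uIcc (-(1:ℝ)/2) (1/2),
      ‖kernelDiff δ (R t) • f (s - t) - kernelDiff δ (r t) • f s‖
        ≤ M * C1norm f * (δ ^ 2 / (t ^ 2 + δ ^ 2)) := by
    intro t ht
    have htr : |t| ≤ r t := by
      rw [← sqrt_sq_eq_abs]
      exact sqrt_le_sqrt (by nlinarith [sq_nonneg ε])
    obtain ⟨h1, h2⟩ := kernelDiff_error_le hc hc1 (abs_nonneg κmax) hδ (hr t) htr (hRr t ht)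
      ((hX.abs_norm_Rvec_sub_le ε s t θ).trans (by gcongr; exact le_abs_self _))
    have e : kernelDiff δ (R t) • f (s - t) - kernelDiff δ (r t) • f s
        = kernelDiff δ (R t) • (f (s - t) - f s)
          + (kernelDiff δ (R t) - kernelDiff δ (r t)) • f s := by module
    rw [e]
    refine (norm_add_le _ _).trans ?_
    rw [norm_smul, norm_smul, norm_eq_abs, norm_eq_abs]
    set D := δ ^ 2 / (t ^ 2 + δ ^ 2)
    have hD : 0 ≤ D := by positivity
    calc _ ≤ |kernelDiff δ (R t)| * (C0norm (deriv f) * |t|)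
            + |kernelDiff δ (R t) - kernelDiff δ (r t)| * C0norm f := by
          gcongr
          exact norm_sub_le_C0norm_deriv hf hfp s t
      _ = (|kernelDiff δ (R t)| * |t|) * C0norm (deriv f)
            + |kernelDiff δ (R t) - kernelDiff δ (r t)| * C0norm f := by ring
      _ ≤ (1 / c ^ 3 * D) * C0norm (deriv f) + (3 * |κmax| / c ^ 4 * D) * C0norm f := by
          gcongr
      _ ≤ M * C1norm f * D := by
          have : 0 ≤ 1 / c ^ 3 * D * C0norm f
            + 3 * |κmax| / c ^ 4 * D * C0norm (deriv f) := by positivity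
          rw [C1norm, hM_def]
          linarith
  have hint : IntervalIntegrable (fun t => kernelDiff δ (R t) • f (s - t)) volume
      (-(1:ℝ)/2) (1/2) := by
    have hRc : Continuous R := hX.continuous_norm_Rvec ε s θ
    refine ContinuousOn.intervalIntegrable
      (ContinuousOn.smul (f := fun t => kernelDiff δ (R t)) (g := fun t => f (s - t)) ?_ ?_)
    · refine ContinuousOn.sub ?_ ?_
      · exact ((by fun_prop : Continuous fun t => √(R t ^ 2 + δ ^ 2)).inv₀
          fun t => (sqrt_sq_add_sq_pos hδ _).ne').continuousOn
      · exact hRc.continuousOn.inv₀ fun t ht =>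
          ((mul_pos hc (hr t)).trans_le (hRr t ht)).ne'
    · have := hf.continuous
      fun_prop
  have hint' : IntervalIntegrable (fun t => kernelDiff δ (r t) • f s) volume
      (-(1:ℝ)/2) (1/2) :=
    ((continuous_kernelDiff_sqrt hε).smul continuous_const).intervalIntegrable _ _
  have hmain := abs_integral_kernelDiff_add_log_le (δ := δ) hε
  have hdiff : ‖∫ t in (-(1:ℝ)/2)..(1/2),
      (kernelDiff δ (R t) • f (s - t) - kernelDiff δ (r t) • f s)‖
        ≤ M * C1norm f * (π * δ) := by
    refine (norm_integral_le_of_norm_le (by norm_num) (ae_of_all _ fun t ht => hpt t ?_)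
      (((continuous_sq_div_sq_add_sq hδ).const_mul _).intervalIntegrable _ _)).trans ?_
    · rw [uIcc_of_le (by norm_num)]
      exact Ioc_subset_Icc_self ht
    · rw [intervalIntegral.integral_const_mul]
      have : 0 ≤ C1norm f := add_nonneg hF00 hF1
      gcongr
      exact integral_sq_div_sq_add_sq_le hδ _ _
  rw [integral_sub hint hint', intervalIntegral.integral_smul_const] at hdiff
  set I := ∫ t in (-(1:ℝ)/2)..(1/2), kernelDiff δ (R t) • f (s - t) with hI
  set J := ∫ t in (-(1:ℝ)/2)..(1/2), kernelDiff δ (r t) with hJ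
  set a := √(ε ^ 2 + δ ^ 2) with ha_def
  have hasq : a ^ 2 = ε ^ 2 + δ ^ 2 := sq_sqrt (by positivity)
  have ha0 : 0 ≤ a := sqrt_nonneg _
  have hδa : δ ≤ a := le_sqrt_of_sq_le (by nlinarith [sq_nonneg ε])
  have hx : ε ^ 2 + δ ^ 2 ≤ 1 / 8 := by nlinarith
  have ha1 : a ≤ 1 := by nlinarith
  have hlog := one_le_abs_log (by positivity) hx
  have hC1 : 0 ≤ C1norm f := add_nonneg hF00 hF1
  have hfC : ‖f s‖ ≤ C1norm f := hF0.trans (by rw [C1norm]; linarith)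
  have e : I + log (1 + δ ^ 2 / ε ^ 2) • f s
      = (I - J • f s) + (J + log (1 + δ ^ 2 / ε ^ 2)) • f s := by module
  change ‖I + log (1 + δ ^ 2 / ε ^ 2) • f s‖ ≤ _
  calc ‖I + log (1 + δ ^ 2 / ε ^ 2) • f s‖
      ≤ ‖I - J • f s‖ + |J + log (1 + δ ^ 2 / ε ^ 2)| * ‖f s‖ := by
        rw [e, ← norm_eq_abs, ← norm_smul]
        exact norm_add_le _ _
    _ ≤ M * C1norm f * (π * a) + (2 * a) * C1norm f := by
        gcongr
        · exact hdiff.trans (by gcongr)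
        · refine hmain.trans ?_
          rw [← hasq]
          nlinarith
    _ = (M * π + 2) * C1norm f * a := by ring
    _ ≤ (M * π + 2) * C1norm f * a * |log (ε ^ 2 + δ ^ 2)| :=
        le_mul_of_one_le_right (by positivity) hlog
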